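/- (Commutator solution for the Friedrichs model.) Let f, g ∈ L²([0,1], μ_d) satisfy k·g(k) = i f(k) for μ_d-almost every k. Then the bounded operators on 𝓗 satisfy the commutator identity H_F σ(g) − σ(g) H_F = i σ(f). -/

import Mathlib

open MeasureTheory

/-- The measure `μ_d = k^{d-1} dk` on `[0,1] ⊆ ℝ`. -/
noncomputable def muF (d : ℝ) : Measure ℝ :=
  (volume.restrict (Set.Icc (0:ℝ) 1)).withDensity fun k => ENNReal.ofReal (k ^ (d - 1))

/-- The Hilbert space `𝓗 = ℂ ⊕ L²([0,1], μ_d)` of the Friedrichs model. -/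
noncomputable abbrev HFSpace (d : ℝ) := WithLp 2 (ℂ × Lp ℂ 2 (muF d))

/-- The vector `(β, u) ∈ 𝓗`. -/
noncomputable def mkH (d : ℝ) (β : ℂ) (u : Lp ℂ 2 (muF d)) : HFSpace d :=
  (WithLp.equiv 2 (ℂ × Lp ℂ 2 (muF d))).symm (β, u)

lemma ae_muF_mem_Icc (d : ℝ) : ∀ᵐ k ∂(muF d), k ∈ Set.Icc (0 : ℝ) 1 :=
  (withDensity_absolutelyContinuous _ _).ae_le (ae_restrict_mem measurableSet_Icc)

/-- Multiplication by the momentum variable preserves `L²(μ_d)`. -/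
lemma memLp_ofReal_mul (d : ℝ) (u : Lp ℂ 2 (muF d)) :
    MemLp (fun k : ℝ => (k : ℂ) * u k) 2 (muF d) := by
  refine (Lp.memLp u).mono
    (Complex.continuous_ofReal.aestronglyMeasurable.mul (Lp.aestronglyMeasurable u)) ?_
  filter_upwards [ae_muF_mem_Icc d] with k hk
  rw [norm_mul, Complex.norm_real, Real.norm_of_nonneg hk.1]
  exact mul_le_of_le_one_left (norm_nonneg _) hk.2

/-- If `k g(k) = i f(k)` and `v(k) = k u(k)`, then `⟨g, v⟩ = -i ⟨f, u⟩`. -/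
lemma inner_eq_neg_I_mul_inner {d : ℝ} {f g u v : Lp ℂ 2 (muF d)}
    (hfg : ∀ᵐ (k : ℝ) ∂(muF d), (k : ℂ) * g k = Complex.I * f k)
    (hv : ⇑v =ᵐ[muF d] fun k : ℝ => (k : ℂ) * u k) :
    inner ℂ g v = -(Complex.I * inner ℂ f u) := by
  rw [L2.inner_def, L2.inner_def, ← integral_const_mul, ← integral_neg]
  refine integral_congr_ae ?_
  filter_upwards [hfg, hv] with k hk hvk
  have hconj := congrArg (starRingEnd ℂ) hk
  simp only [map_mul, Complex.conj_ofReal, Complex.conj_I] at hconj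
  simp only [RCLike.inner_apply, hvk]
  linear_combination u k * hconj

/-- **Commutator solution for the Friedrichs model.** Fix `d > 0`. Let
`f, g ∈ L²([0,1], μ_d)` with `k·g(k) = i f(k)` for `μ_d`-a.e. `k`. Let `H_F` be the
Friedrichs Hamiltonian, `H_F(β,u) = (0, k·u(k))`, and for `h ∈ L²` let
`σ(h)(β,u) = (⟨h,u⟩, β h)`. Then `H_F σ(g) − σ(g) H_F = i σ(f)` as bounded operators
on `𝓗`. -/
theorem stmt_8 (d : ℝ) (hd : 0 < d)
    (f g : Lp ℂ 2 (muF d))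
    (hfg : ∀ᵐ (k : ℝ) ∂(muF d), (k : ℂ) * g k = Complex.I * f k)
    (HF Sf Sg : HFSpace d →L[ℂ] HFSpace d)
    (hHF : ∀ (β : ℂ) (u v : Lp ℂ 2 (muF d)),
      (⇑v =ᵐ[muF d] fun k : ℝ => (k : ℂ) * u k) → HF (mkH d β u) = mkH d 0 v)
    (hSf : ∀ (β : ℂ) (u : Lp ℂ 2 (muF d)),
      Sf (mkH d β u) = mkH d (@inner ℂ _ _ f u) (β • f))
    (hSg : ∀ (β : ℂ) (u : Lp ℂ 2 (muF d)),
      Sg (mkH d β u) = mkH d (@inner ℂ _ _ g u) (β • g)) :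
    HF * Sg - Sg * HF = Complex.I • Sf := by
  ext1 x
  obtain ⟨β, u, rfl⟩ : ∃ β u, x = mkH d β u := ⟨x.fst, x.snd, rfl⟩
  have hv := (memLp_ofReal_mul d u).coeFn_toLp
  have hg : ⇑((Complex.I * β) • f) =ᵐ[muF d]
      fun k : ℝ => (k : ℂ) * (β • g : Lp ℂ 2 (muF d)) k := by
    filter_upwards [hfg, Lp.coeFn_smul (Complex.I * β) f, Lp.coeFn_smul β g] with k hk h₁ h₂
    rw [h₁, h₂, Pi.smul_apply, Pi.smul_apply, smul_eq_mul, smul_eq_mul]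
    linear_combination -β * hk
  simp only [sub_apply, mul_apply_eq_comp, smul_apply]
  rw [hSg, hHF _ _ _ hg, hHF _ _ _ hv, hSg, hSf, inner_eq_neg_I_mul_inner hfg hv]
  apply (WithLp.equiv 2 (ℂ × Lp ℂ 2 (muF d))).injective
  refine Prod.ext ?_ ?_ <;> simp [mkH, mul_smul]
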